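/- Let 𝒳 be a set, F a class of real-valued functions on 𝒳, λ > 0, σ_min > 0, points X_1, …, X_T ∈ 𝒳 and weights σ̄_1, …, σ̄_T with σ̄_t ≥ σ_min for all t. Let [T] be partitioned into K consecutive intervals (blocks) I_1, …, I_K. Then the number of blocks k ∈ [K] for which Σ_{t ∈ I_k} σ̄_t^{−2} D²_F(X_t; X_{[t−1]}, σ̄_{[t−1]}) > 1 is at most dim_F(σ_min, T). -/

import Mathlib

open scoped Classical

/-- The set of ratios whose supremum defines the squared uncertainty
`D²_F(x; X_[n], σ_[n])`. -/
def uncSet {𝒳 : Type*} (F : Set (𝒳 → ℝ)) (lam : ℝ) (xs : ℕ → 𝒳) (sig : ℕ → ℝ)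
    (n : ℕ) (x : 𝒳) : Set ℝ :=
  { r | ∃ f₁ ∈ F, ∃ f₂ ∈ F,
      r = (f₁ x - f₂ x) ^ 2 /
        ((∑ s ∈ Finset.Icc 1 n, (sig s ^ 2)⁻¹ * (f₁ (xs s) - f₂ (xs s)) ^ 2) + lam) }

/-- Squared uncertainty `D²_F(x; X_[n], σ_[n])`. -/
noncomputable def uncertaintySq {𝒳 : Type*} (F : Set (𝒳 → ℝ)) (lam : ℝ)
    (xs : ℕ → 𝒳) (sig : ℕ → ℝ) (n : ℕ) (x : 𝒳) : ℝ :=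
  sSup (uncSet F lam xs sig n x)

/-- Generalized Eluder dimension `dim_F(σ_min, T)`. -/
noncomputable def eluderDim {𝒳 : Type*} (F : Set (𝒳 → ℝ)) (lam smin : ℝ) (T : ℕ) : ℝ :=
  ⨆ p : (ℕ → 𝒳) × {s : ℕ → ℝ // ∀ t, smin ≤ s t},
    ∑ t ∈ Finset.Icc 1 T,
      min 1 ((p.2.1 t ^ 2)⁻¹ * uncertaintySq F lam p.1 p.2.1 (t - 1) (p.1 t))

theorem uncertaintySq_nonneg {𝒳 : Type*} (F : Set (𝒳 → ℝ)) {lam : ℝ} (hlam : 0 < lam)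
    (xs : ℕ → 𝒳) (sig : ℕ → ℝ) (n : ℕ) (x : 𝒳) : 0 ≤ uncertaintySq F lam xs sig n x := by
  refine Real.sSup_nonneg ?_
  rintro r ⟨f₁, -, f₂, -, rfl⟩
  positivity

/-- Truncating nonnegative terms at `1` cannot bring a sum exceeding `1` below `1`. -/
theorem one_le_sum_min_one {ι : Type*} (s : Finset ι) (g : ι → ℝ) (hg : ∀ i ∈ s, 0 ≤ g i)
    (h : 1 < ∑ i ∈ s, g i) : 1 ≤ ∑ i ∈ s, min 1 (g i) := by
  by_cases hex : ∃ i ∈ s, 1 ≤ g i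
  · obtain ⟨i, his, hi⟩ := hex
    calc (1 : ℝ) = min 1 (g i) := (min_eq_left hi).symm
      _ ≤ ∑ j ∈ s, min 1 (g j) :=
        Finset.single_le_sum (f := fun j => min 1 (g j))
          (fun j hj => le_min zero_le_one (hg j hj)) his
  · push Not at hex
    rw [Finset.sum_congr rfl fun i hi => min_eq_right (hex i hi).le]
    exact h.le

theorem sum_range_sum_Ioc_consecutive (g : ℕ → ℝ) (b : ℕ → ℕ) (K : ℕ)
    (hmono : ∀ k < K, b k ≤ b (k + 1)) :
    b 0 ≤ b K ∧
      ∑ k ∈ Finset.range K, ∑ t ∈ Finset.Ioc (b k) (b (k + 1)), g t =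
        ∑ t ∈ Finset.Ioc (b 0) (b K), g t := by
  induction K with
  | zero => simp
  | succ K ih =>
    obtain ⟨hle, hsum⟩ := ih fun k hk => hmono k (hk.trans K.lt_succ_self)
    have hstep := hmono K K.lt_succ_self
    exact ⟨hle.trans hstep, by
      rw [Finset.sum_range_succ, hsum, Finset.sum_Ioc_consecutive g hle hstep]⟩

/-- core of Lemma 8: partition `[T]` into `K` consecutive blocks
`I_k = (b_{k-1}, b_k]`. The number of blocks on which
`Σ_{t ∈ I_k} σ̄_t⁻² D²_F(X_t; X_[t-1], σ̄_[t-1]) > 1` is at most `dim_F(σ_min, T)`. -/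
theorem card_blocks_large_uncertainty_le_eluderDim
    {𝒳 : Type*} [Nonempty 𝒳] (F : Set (𝒳 → ℝ)) (lam smin : ℝ)
    (hlam : 0 < lam) (hsmin : 0 < smin)
    (T : ℕ) (xs : ℕ → 𝒳) (bsig : ℕ → ℝ) (hbsig : ∀ t, smin ≤ bsig t)
    (hbdd : ∀ n x, BddAbove (uncSet F lam xs bsig n x))
    (hdimbdd : BddAbove (Set.range
      fun p : (ℕ → 𝒳) × {s : ℕ → ℝ // ∀ t, smin ≤ s t} =>
        ∑ t ∈ Finset.Icc 1 T,
          min 1 ((p.2.1 t ^ 2)⁻¹ * uncertaintySq F lam p.1 p.2.1 (t - 1) (p.1 t))))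
    (K : ℕ) (b : ℕ → ℕ) (hb0 : b 0 = 0) (hbK : b K = T)
    (hmono : ∀ k < K, b k ≤ b (k + 1)) :
    (((Finset.range K).filter (fun k =>
        1 < ∑ t ∈ Finset.Ioc (b k) (b (k + 1)),
          (bsig t ^ 2)⁻¹ * uncertaintySq F lam xs bsig (t - 1) (xs t))).card : ℝ)
      ≤ eluderDim F lam smin T := by
  set g : ℕ → ℝ := fun t => (bsig t ^ 2)⁻¹ * uncertaintySq F lam xs bsig (t - 1) (xs t) with hg
  have hg0 : ∀ t, 0 ≤ g t := fun t =>
    mul_nonneg (by positivity) (uncertaintySq_nonneg F hlam xs bsig _ _)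
  have hblocks := (sum_range_sum_Ioc_consecutive (fun t => min 1 (g t)) b K hmono).2
  rw [hb0, hbK] at hblocks
  calc _ ≤ ∑ k ∈ Finset.range K, ∑ t ∈ Finset.Ioc (b k) (b (k + 1)), min 1 (g t) := by
        rw [Finset.card_filter, Nat.cast_sum]
        refine Finset.sum_le_sum fun k _ => ?_
        split_ifs with hk
        · simpa using one_le_sum_min_one _ g (fun t _ => hg0 t) hk
        · simpa using Finset.sum_nonneg fun t _ => le_min zero_le_one (hg0 t)
    _ = ∑ t ∈ Finset.Icc 1 T, min 1 (g t) := hblocks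
    _ ≤ eluderDim F lam smin T := le_ciSup hdimbdd (xs, ⟨bsig, hbsig⟩)
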